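/- arXiv:1006.5718 — 3 statements merged into one kernel-verified Lean document; each statement's English description precedes it below -/
import Mathlib

section
/- Define M₁(τ,λ) = (∂Φ/∂τ)(τ,λ)·Φ(τ,λ)⁻¹, V(λ) = (∂Φ/∂λ)(0,λ)·Φ(0,λ)⁻¹, and F(τ,σ,λ) = Φ(τ,λ)·Φ(σ,λ)⁻¹. Then for every (τ,λ) ∈ [0,T) × Λ: (∂Φ/∂λ)(τ,λ)·Φ(τ,λ)⁻¹ = V(λ) + ∫₀^τ F(τ,σ,λ)·[(∂M₁/∂λ)(σ,λ) − V(λ)M₁(σ,λ) + M₁(σ,λ)V(λ)]·F(τ,σ,λ)⁻¹ dσ. -/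
open Matrix
noncomputable section
attribute [local instance] Matrix.normedAddCommGroup Matrix.normedSpace

/-- Square real matrices. -/
abbrev Mat (n : ℕ) := Matrix (Fin n) (Fin n) ℝ

/-- cos of a square real matrix, as a power series. -/
noncomputable def mcos {n : ℕ} (X : Mat n) : Mat n :=
  ∑' k : ℕ, ((-1 : ℝ) ^ k / (Nat.factorial (2 * k) : ℝ)) • X ^ (2 * k)

/-- sin of a square real matrix, as a power series. -/
noncomputable def msin {n : ℕ} (X : Mat n) : Mat n :=
  ∑' k : ℕ, ((-1 : ℝ) ^ k / (Nat.factorial (2 * k + 1) : ℝ)) • X ^ (2 * k + 1)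

open MeasureTheory Topology Filter Set

/-- A primitive of a continuous function on `[a,b]` is differentiable within `[a,b]`. -/
lemma pdf_hasDerivWithinAt_primitive {E : Type*} [NormedAddCommGroup E] [NormedSpace ℝ E]
    [CompleteSpace E] {a b : ℝ} (hab : a ≤ b) {f g : ℝ → E} {c : E}
    (hg : ContinuousOn g (Icc a b))
    (hf : ∀ u ∈ Icc a b, f u = c + ∫ s in a..u, g s) :
    ∀ u ∈ Icc a b, HasDerivWithinAt f (g u) (Icc a b) u := by
  intro u hu
  set G : ℝ → E := IccExtend hab ((Icc a b).domRestrict g) with hG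
  have hGc : Continuous G := hg.domRestrict.Icc_extend'
  have hGe : ∀ v ∈ Icc a b, G v = g v := fun v hv => by
    rw [hG, IccExtend_of_mem hab _ hv]
    rfl
  have h1 : HasDerivAt (fun u => c + ∫ s in a..u, G s) (G u) u :=
    ((hGc.integral_hasStrictDerivAt a u).hasDerivAt).const_add c
  rw [← hGe u hu]
  have key : ∀ v ∈ Icc a b, f v = c + ∫ s in a..v, G s := by
    intro v hv
    rw [hf v hv]
    congr 1
    apply intervalIntegral.integral_congr
    intro s hs
    rw [uIcc_of_le hv.1] at hs
    exact (hGe s ⟨hs.1, hs.2.trans hv.2⟩).symm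
  exact h1.hasDerivWithinAt.congr key (key u hu)

/-- Differentiation under the integral sign combined with the fundamental theorem. -/
lemma pdf_mixed {E : Type*} [NormedAddCommGroup E] [NormedSpace ℝ E]
    [CompleteSpace E] {b : ℝ} (hb : 0 ≤ b) {Λ : Set ℝ} (hΛ : IsOpen Λ)
    {f ft fm fmt : ℝ → ℝ → E}
    (hft : ∀ t ∈ Icc 0 b, ∀ l ∈ Λ, HasDerivWithinAt (fun s => f s l) (ft t l) (Icc 0 b) t)
    (hfm : ∀ t ∈ Icc 0 b, ∀ l ∈ Λ, HasDerivAt (fun m => f t m) (fm t l) l)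
    (hfmt : ∀ t ∈ Icc 0 b, ∀ l ∈ Λ, HasDerivAt (fun m => ft t m) (fmt t l) l)
    (hftc : ContinuousOn (fun p : ℝ × ℝ => ft p.1 p.2) (Icc 0 b ×ˢ Λ))
    (hfmtc : ContinuousOn (fun p : ℝ × ℝ => fmt p.1 p.2) (Icc 0 b ×ˢ Λ))
    {l : ℝ} (hl : l ∈ Λ) :
    ∀ u ∈ Icc 0 b, fm u l = fm 0 l + ∫ s in (0:ℝ)..u, fmt s l := by
  intro u hu
  have h0 : (0:ℝ) ∈ Icc 0 b := ⟨le_rfl, hb⟩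
  have hsub : Icc 0 u ⊆ Icc 0 b := Icc_subset_Icc le_rfl hu.2
  have slice : ∀ (h : ℝ → ℝ → E), ContinuousOn (fun p : ℝ × ℝ => h p.1 p.2) (Icc 0 b ×ˢ Λ) →
      ∀ m ∈ Λ, ContinuousOn (fun s => h s m) (Icc 0 u) := by
    intro h hh m hm
    have : ContinuousOn (fun s : ℝ => (s, m)) (Icc 0 u) := by fun_prop
    exact hh.comp this (fun s hs => ⟨hsub hs, hm⟩)
  have hInteg : ∀ (h : ℝ → ℝ → E), ContinuousOn (fun p : ℝ × ℝ => h p.1 p.2) (Icc 0 b ×ˢ Λ) →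
      ∀ m ∈ Λ, IntervalIntegrable (fun s => h s m) volume 0 u := fun h hh m hm =>
    ContinuousOn.intervalIntegrable_of_Icc hu.1 (slice h hh m hm)
  have hrep : ∀ m ∈ Λ, f u m = f 0 m + ∫ s in (0:ℝ)..u, ft s m := by
    intro m hm
    rw [intervalIntegral.integral_eq_sub_of_hasDerivAt_of_le (f := fun s => f s m) hu.1
      (fun s hs => ((hft s (hsub hs) m hm).continuousWithinAt).mono hsub)
      (fun s hs => (hft s (hsub (Ioo_subset_Icc_self hs)) m hm).hasDerivAt
        (Icc_mem_nhds hs.1 (hs.2.trans_le hu.2))) (hInteg ft hftc m hm)]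
    abel
  obtain ⟨ε, hε, hball⟩ := Metric.nhds_basis_closedBall.mem_iff.1 (hΛ.mem_nhds hl)
  have hK : IsCompact (Icc 0 u ×ˢ Metric.closedBall l ε) :=
    isCompact_Icc.prod (isCompact_closedBall l ε)
  obtain ⟨C, hC⟩ := hK.exists_bound_of_continuousOn
    (hfmtc.mono (prod_mono hsub hball))
  have hmem : ∀ t ∈ uIoc 0 u, t ∈ Icc 0 u := fun t ht => by
    rw [uIoc_of_le hu.1] at ht
    exact Ioc_subset_Icc_self ht
  have hder := (intervalIntegral.hasDerivAt_integral_of_dominated_loc_of_deriv_le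
    (μ := volume) (a := 0) (b := u) (F := fun m s => ft s m) (F' := fun m s => fmt s m)
    (bound := fun _ => C) (x₀ := l) (Metric.closedBall_mem_nhds l hε)
    (by
      filter_upwards [hΛ.mem_nhds hl] with m hm
      exact (intervalIntegrable_iff.1 (hInteg ft hftc m hm)).aestronglyMeasurable)
    (hInteg ft hftc l hl)
    (intervalIntegrable_iff.1 (hInteg fmt hfmtc l hl)).aestronglyMeasurable
    (Eventually.of_forall fun t ht m hm => hC (t, m) ⟨hmem t ht, hm⟩)
    (by simp)
    (Eventually.of_forall fun t ht m hm => hfmt t (hsub (hmem t ht)) m (hball hm))).2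
  have h2 := (hfm 0 h0 l hl).add hder
  refine (hfm u hu l hl).unique (h2.congr_of_eventuallyEq ?_)
  filter_upwards [hΛ.mem_nhds hl] with m hm
  exact hrep m hm

/-- Product rule for matrices. -/
lemma pdf_mul {N : ℕ} {A B : ℝ → Matrix (Fin N) (Fin N) ℝ} {A' B' : Matrix (Fin N) (Fin N) ℝ}
    {s : Set ℝ} {t : ℝ} (hA : HasDerivWithinAt A A' s t) (hB : HasDerivWithinAt B B' s t) :
    HasDerivWithinAt (fun x => A x * B x) (A' * B t + A t * B') s t := by
  have hA1 : ∀ i j, HasDerivWithinAt (fun x => A x i j) (A' i j) s t := fun i j =>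
    hasDerivWithinAt_pi.1 (hasDerivWithinAt_pi.1 hA i) j
  have hB1 : ∀ i j, HasDerivWithinAt (fun x => B x i j) (B' i j) s t := fun i j =>
    hasDerivWithinAt_pi.1 (hasDerivWithinAt_pi.1 hB i) j
  refine hasDerivWithinAt_pi.2 fun i => hasDerivWithinAt_pi.2 fun j => ?_
  have := HasDerivWithinAt.fun_sum (u := Finset.univ)
    (fun k _ => (hA1 i k).mul (hB1 k j))
  simpa [Matrix.mul_apply, Finset.sum_add_distrib] using this

/-- Continuity of the inverse. -/
lemma pdf_inv_cont {N : ℕ} {A : ℝ → Matrix (Fin N) (Fin N) ℝ}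
    {s : Set ℝ} {t : ℝ} (hA : ContinuousWithinAt A s t) (hu : IsUnit (A t).det) :
    ContinuousWithinAt (fun x => (A x)⁻¹) s t := by
  have h : ContinuousAt Inv.inv (A t) := continuousAt_matrix_inv _ (by
    rw [Ring.inverse_eq_inv']
    exact continuousAt_inv₀ hu.ne_zero)
  exact h.comp_continuousWithinAt hA

/-- Derivative of the inverse. -/
lemma pdf_inv {N : ℕ} {A : ℝ → Matrix (Fin N) (Fin N) ℝ} {A' : Matrix (Fin N) (Fin N) ℝ}
    {s : Set ℝ} {t : ℝ} (ht : t ∈ s) (hA : HasDerivWithinAt A A' s t)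
    (hu : ∀ x ∈ s, IsUnit (A x).det) :
    HasDerivWithinAt (fun x => (A x)⁻¹) (-((A t)⁻¹ * A' * (A t)⁻¹)) s t := by
  have hc := (pdf_inv_cont hA.continuousWithinAt (hu t ht)).mono
    (sdiff_subset : s \ {t} ⊆ s)
  have hA2 : Tendsto (slope A t) (𝓝[s \ {t}] t) (𝓝 A') := hasDerivWithinAt_iff_tendsto_slope.1 hA
  refine hasDerivWithinAt_iff_tendsto_slope.2 ?_
  have h : Tendsto (fun x => -((A t)⁻¹ * slope A t x * (A x)⁻¹)) (𝓝[s \ {t}] t)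
      (𝓝 (-((A t)⁻¹ * A' * (A t)⁻¹))) :=
    ((Tendsto.mul (tendsto_const_nhds (x := (A t)⁻¹)) hA2).mul hc.tendsto).neg
  refine h.congr' ?_
  filter_upwards [self_mem_nhdsWithin] with x hx
  have h1 := Matrix.nonsing_inv_mul _ (hu t ht)
  have h2 := Matrix.mul_nonsing_inv _ (hu x hx.1)
  simp only [slope_def_module, Matrix.mul_smul, Matrix.smul_mul, Matrix.mul_sub, Matrix.sub_mul]
  rw [Matrix.mul_assoc _ (A x), h1, h2, Matrix.one_mul, Matrix.mul_one, ← smul_neg, neg_sub]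

/-- The variation-of-parameters formula for the parameter derivative:
`(∂Φ/∂λ)Φ⁻¹ = V + ∫₀^τ F (M₁′ − V M₁ + M₁ V) F⁻¹ dσ`. -/
theorem parameter_derivative_formula
    (N : ℕ) (hN : 1 ≤ N) (T : EReal) (hT : 0 < T)
    (S : Set ℝ) (hS : S = {τ : ℝ | 0 ≤ τ ∧ (τ : EReal) < T})
    (Λ : Set ℝ) (hΛopen : IsOpen Λ) (hΛconn : Λ.OrdConnected)
    (Φ Φτ Φμ Φμτ : ℝ → ℝ → Matrix (Fin N) (Fin N) ℝ)
    (hinv : ∀ τ ∈ S, ∀ l ∈ Λ, IsUnit (Φ τ l).det)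
    (hΦτ : ∀ τ ∈ S, ∀ l ∈ Λ, HasDerivWithinAt (fun σ => Φ σ l) (Φτ τ l) S τ)
    (hΦμ : ∀ τ ∈ S, ∀ l ∈ Λ, HasDerivAt (fun μ => Φ τ μ) (Φμ τ l) l)
    (hΦμτ : ∀ τ ∈ S, ∀ l ∈ Λ, HasDerivAt (fun μ => Φτ τ μ) (Φμτ τ l) l)
    (hΦcont : ContinuousOn (fun p : ℝ × ℝ => Φ p.1 p.2) (S ×ˢ Λ))
    (hΦτcont : ContinuousOn (fun p : ℝ × ℝ => Φτ p.1 p.2) (S ×ˢ Λ))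
    (hΦμτcont : ContinuousOn (fun p : ℝ × ℝ => Φμτ p.1 p.2) (S ×ˢ Λ))
    (M₁ M₁μ : ℝ → ℝ → Matrix (Fin N) (Fin N) ℝ)
    (hM₁ : ∀ τ l, M₁ τ l = Φτ τ l * (Φ τ l)⁻¹)
    (hM₁μ : ∀ τ ∈ S, ∀ l ∈ Λ, HasDerivAt (fun μ => M₁ τ μ) (M₁μ τ l) l)
    (V : ℝ → Matrix (Fin N) (Fin N) ℝ) (hV : ∀ l, V l = Φμ 0 l * (Φ 0 l)⁻¹)
    (F : ℝ → ℝ → ℝ → Matrix (Fin N) (Fin N) ℝ)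
    (hF : ∀ τ σ l, F τ σ l = Φ τ l * (Φ σ l)⁻¹) :
    ∀ τ ∈ S, ∀ l ∈ Λ,
      Φμ τ l * (Φ τ l)⁻¹ = V l +
        ∫ σ in (0:ℝ)..τ,
          F τ σ l * (M₁μ σ l - V l * M₁ σ l + M₁ σ l * V l) * (F τ σ l)⁻¹ := by
  subst hS
  intro τ hτ l hl
  have h0τ : (0:ℝ) ≤ τ := hτ.1
  have hsub : Icc 0 τ ⊆ {τ : ℝ | 0 ≤ τ ∧ (τ : EReal) < T} := fun s hs =>
    ⟨hs.1, lt_of_le_of_lt (EReal.coe_le_coe_iff.2 hs.2) hτ.2⟩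
  have h0 : (0:ℝ) ∈ Icc 0 τ := ⟨le_rfl, h0τ⟩
  have hτ' : τ ∈ Icc 0 τ := ⟨h0τ, le_rfl⟩
  have hprod := prod_mono hsub (subset_refl Λ)
  have hI : ∀ s ∈ Icc 0 τ, IsUnit (Φ s l).det := fun s hs => hinv s (hsub hs) l hl
  have hΦd : ∀ s ∈ Icc 0 τ, HasDerivWithinAt (fun σ => Φ σ l) (Φτ s l) (Icc 0 τ) s :=
    fun s hs => (hΦτ s (hsub hs) l hl).mono hsub
  have slice : ∀ (h : ℝ → ℝ → Matrix (Fin N) (Fin N) ℝ),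
      ContinuousOn (fun p : ℝ × ℝ => h p.1 p.2) ({τ : ℝ | 0 ≤ τ ∧ (τ : EReal) < T} ×ˢ Λ) →
      ContinuousOn (fun s => h s l) (Icc 0 τ) := by
    intro h hh
    have : ContinuousOn (fun s : ℝ => (s, l)) (Icc 0 τ) := by fun_prop
    exact hh.comp this (fun s hs => ⟨hsub hs, hl⟩)
  have hΦc := slice Φ hΦcont
  have hΦτc := slice Φτ hΦτcont
  have hΦμτc := slice Φμτ hΦμτcont
  have hmix := pdf_mixed h0τ hΛopen
    (fun t ht m hm => (hΦτ t (hsub ht) m hm).mono hsub)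
    (fun t ht m hm => hΦμ t (hsub ht) m hm)
    (fun t ht m hm => hΦμτ t (hsub ht) m hm)
    (hΦτcont.mono hprod) (hΦμτcont.mono hprod) hl
  have hΦμd := pdf_hasDerivWithinAt_primitive h0τ hΦμτc hmix
  have hΦμc : ContinuousOn (fun s => Φμ s l) (Icc 0 τ) :=
    fun s hs => (hΦμd s hs).continuousWithinAt
  have hΦic : ContinuousOn (fun s => (Φ s l)⁻¹) (Icc 0 τ) :=
    fun s hs => pdf_inv_cont (hΦc s hs) (hI s hs)
  -- the parameter derivative of `M₁`
  have hM : ∀ s ∈ Icc 0 τ, M₁μ s l = Φμτ s l * (Φ s l)⁻¹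
      - Φτ s l * (Φ s l)⁻¹ * Φμ s l * (Φ s l)⁻¹ := by
    intro s hs
    have h1 := pdf_mul (s := univ) (hM₁μ s (hsub hs) l hl).hasDerivWithinAt
      (hΦμ s (hsub hs) l hl).hasDerivWithinAt
    replace h1 := hasDerivWithinAt_univ.1 h1
    have h2 : HasDerivAt (fun m => M₁ s m * Φ s m) (Φμτ s l) l := by
      refine (hΦμτ s (hsub hs) l hl).congr_of_eventuallyEq ?_
      filter_upwards [hΛopen.mem_nhds hl] with m hm
      rw [hM₁, Matrix.mul_assoc, Matrix.nonsing_inv_mul _ (hinv s (hsub hs) m hm), Matrix.mul_one]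
    rw [h2.unique h1, ← hM₁, Matrix.add_mul, Matrix.mul_assoc (M₁μ s l),
      Matrix.mul_nonsing_inv _ (hI s hs), Matrix.mul_one, add_sub_cancel_right]
  set P := Φ τ l with hP
  set W := V l with hW
  let K' : ℝ → Matrix (Fin N) (Fin N) ℝ := fun s =>
    P * ((-((Φ s l)⁻¹ * Φτ s l * (Φ s l)⁻¹)) * (Φμ s l - W * Φ s l)
      + (Φ s l)⁻¹ * (Φμτ s l - W * Φτ s l)) * P⁻¹
  let K : ℝ → Matrix (Fin N) (Fin N) ℝ := fun s =>
    P * ((Φ s l)⁻¹ * (Φμ s l - W * Φ s l)) * P⁻¹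
  have hKd : ∀ s ∈ Icc 0 τ, HasDerivWithinAt K (K' s) (Icc 0 τ) s := by
    intro s hs
    have hc : ∀ Q : Matrix (Fin N) (Fin N) ℝ,
        HasDerivWithinAt (fun _ : ℝ => Q) 0 (Icc 0 τ) s := fun Q => hasDerivWithinAt_const _ _ _
    have a1 := pdf_mul (hc W) (hΦd s hs)
    have a2 := pdf_mul (pdf_inv hs (hΦd s hs) hI) ((hΦμd s hs).sub a1)
    have a3 := pdf_mul (pdf_mul (hc P) a2) (hc P⁻¹)
    simpa [K, K'] using a3
  have hK'c : ContinuousOn K' (Icc 0 τ) := by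
    refine (continuousOn_const.mul (ContinuousOn.add ?_ ?_)).mul continuousOn_const
    · exact (((hΦic.mul hΦτc).mul hΦic).neg).mul (hΦμc.sub (continuousOn_const.mul hΦc))
    · exact hΦic.mul (hΦμτc.sub (continuousOn_const.mul hΦτc))
  have hFTC : ∫ s in (0:ℝ)..τ, K' s = K τ - K 0 :=
    intervalIntegral.integral_eq_sub_of_hasDerivAt_of_le h0τ
      (fun s hs => (hKd s hs).continuousWithinAt)
      (fun s hs => (hKd s (Ioo_subset_Icc_self hs)).hasDerivAt (Icc_mem_nhds hs.1 hs.2))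
      (ContinuousOn.intervalIntegrable_of_Icc h0τ hK'c)
  have hcongr : ∫ σ in (0:ℝ)..τ,
      F τ σ l * (M₁μ σ l - W * M₁ σ l + M₁ σ l * W) * (F τ σ l)⁻¹ = ∫ s in (0:ℝ)..τ, K' s := by
    apply intervalIntegral.integral_congr
    intro s hs
    rw [uIcc_of_le h0τ] at hs
    have e1 := Matrix.nonsing_inv_mul _ (hI s hs)
    have e2 := Matrix.mul_nonsing_inv _ (hI s hs)
    have e3 : ∀ X, (Φ s l)⁻¹ * (Φ s l * X) = X := fun X => by
      rw [← Matrix.mul_assoc, e1, Matrix.one_mul]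
    simp only [K', hF, hM s hs, hM₁, Matrix.mul_inv_rev, Matrix.nonsing_inv_nonsing_inv _ (hI s hs),
      ← hP, Matrix.mul_add, Matrix.add_mul, Matrix.mul_sub, Matrix.sub_mul, Matrix.mul_assoc, e3,
      Matrix.neg_mul, Matrix.mul_neg]
    abel
  have hK0 : K 0 = 0 := by
    simp only [K, hW, hV]
    rw [Matrix.mul_assoc (Φμ 0 l), Matrix.nonsing_inv_mul _ (hI 0 h0)]
    simp
  have hKτ : K τ = Φμ τ l * P⁻¹ - W := by
    have e2 := Matrix.mul_nonsing_inv _ (hI τ hτ')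
    simp only [K, ← hP] at e2 ⊢
    rw [← Matrix.mul_assoc, e2, Matrix.one_mul, Matrix.sub_mul, Matrix.mul_assoc W, e2,
      Matrix.mul_one]
  rw [hcongr, hFTC, hK0, hKτ]
  abel
end
end

section
/- Let k₁ ∈ ℝ and k₂ > 0, and define r(τ) = k₂^{−1/2}·√(cos²τ + (k₁cos τ + k₂sin τ)²) for τ ∈ ℝ. Then there exists a strictly increasing continuous function ξ : ℝ → ℝ with −π/2 < ξ(0) < π/2 such that for every τ ∈ ℝ: k₂^{−1/2}·cos τ = r(τ)·cos ξ(τ) and k₂^{−1/2}·(k₁cos τ + k₂sin τ) = r(τ)·sin ξ(τ). Moreover, tan ξ(τ) = k₁ + k₂·tan τ for every τ ∉ π/2 + πℤ, ξ(π/2 + kπ) = π/2 + kπ for every k ∈ ℤ, and ξ(τ) → ±∞ as τ → ±∞. -/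
open Matrix
noncomputable section
attribute [local instance] Matrix.normedAddCommGroup Matrix.normedSpace

/-- The one-dimensional example: polar angle `ξ` for
`Q₂(τ) = k₂^{-1/2} cos τ`, `Q₁(τ) = k₂^{-1/2}(k₁ cos τ + k₂ sin τ)`. -/
theorem one_dimensional_polar_angle
    (k₁ k₂ : ℝ) (hk₂ : 0 < k₂) (r : ℝ → ℝ)
    (hr : ∀ τ, r τ = (Real.sqrt k₂)⁻¹ *
      Real.sqrt (Real.cos τ ^ 2 + (k₁ * Real.cos τ + k₂ * Real.sin τ) ^ 2)) :
    ∃ ξ : ℝ → ℝ, StrictMono ξ ∧ Continuous ξ ∧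
      -(Real.pi / 2) < ξ 0 ∧ ξ 0 < Real.pi / 2 ∧
      (∀ τ, (Real.sqrt k₂)⁻¹ * Real.cos τ = r τ * Real.cos (ξ τ) ∧
        (Real.sqrt k₂)⁻¹ * (k₁ * Real.cos τ + k₂ * Real.sin τ) =
          r τ * Real.sin (ξ τ)) ∧
      (∀ τ, (∀ k : ℤ, τ ≠ Real.pi / 2 + k * Real.pi) →
        Real.tan (ξ τ) = k₁ + k₂ * Real.tan τ) ∧
      (∀ k : ℤ, ξ (Real.pi / 2 + k * Real.pi) = Real.pi / 2 + k * Real.pi) ∧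
      Filter.Tendsto ξ Filter.atTop Filter.atTop ∧
      Filter.Tendsto ξ Filter.atBot Filter.atBot := by
  have hc1 : ∀ τ : ℝ, Real.cos τ ^ 2 + Real.sin τ ^ 2 = 1 := fun τ => Real.cos_sq_add_sin_sq τ
  set A : ℝ → ℝ := fun τ => Real.cos τ ^ 2 +
    (k₁ * Real.cos τ + k₂ * Real.sin τ) * Real.sin τ with hA
  set B : ℝ → ℝ := fun τ => (k₁ * Real.cos τ + k₂ * Real.sin τ) * Real.cos τ -
    Real.cos τ * Real.sin τ with hB
  set w : ℝ → ℂ := fun τ => (A τ : ℂ) + (B τ : ℂ) * Complex.I with hw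
  have hre : ∀ τ, (w τ).re = A τ := fun τ => by simp [hw]
  have him : ∀ τ, (w τ).im = B τ := fun τ => by simp [hw]
  have hslit : ∀ τ, w τ ∈ Complex.slitPlane := by
    intro τ
    rw [Complex.mem_slitPlane_iff, hre, him]
    by_cases hb : B τ = 0
    · left
      have h1 : Real.cos τ * ((k₁ * Real.cos τ + k₂ * Real.sin τ) - Real.sin τ) = 0 := by
        rw [← hb]; simp only [hB]; ring
      have h2 := hc1 τ
      rcases mul_eq_zero.mp h1 with h | h
      · rw [h] at h2
        have h3 : A τ = k₂ := by
          simp only [hA, h]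
          linear_combination k₂ * h2
        rw [h3]; exact hk₂
      · have h3 : A τ = 1 := by
          simp only [hA]
          linear_combination h2 + Real.sin τ * h
        rw [h3]; exact one_pos
    · right; exact hb
  have hnormsq : ∀ τ, A τ ^ 2 + B τ ^ 2 =
      Real.cos τ ^ 2 + (k₁ * Real.cos τ + k₂ * Real.sin τ) ^ 2 := by
    intro τ
    simp only [hA, hB]
    linear_combination
      (Real.cos τ ^ 2 + (k₁ * Real.cos τ + k₂ * Real.sin τ) ^ 2) * hc1 τ
  have hnorm : ∀ τ, ‖w τ‖ =
      Real.sqrt (Real.cos τ ^ 2 + (k₁ * Real.cos τ + k₂ * Real.sin τ) ^ 2) := by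
    intro τ
    rw [← hnormsq, Complex.norm_eq_sqrt_sq_add_sq, hre, him]
  have hpos : ∀ τ, 0 < ‖w τ‖ := fun τ =>
    norm_pos_iff.mpr (Complex.slitPlane_ne_zero (hslit τ))
  have hpos2 : ∀ τ, 0 < A τ ^ 2 + B τ ^ 2 := by
    intro τ
    have := hpos τ
    rw [Complex.norm_eq_sqrt_sq_add_sq, hre, him] at this
    exact Real.sqrt_pos.mp this
  set ξ : ℝ → ℝ := fun τ => τ + (w τ).arg with hξ
  have hcos : ∀ τ, ‖w τ‖ * Real.cos (w τ).arg = A τ := fun τ => by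
    rw [Complex.norm_mul_cos_arg, hre]
  have hsin : ∀ τ, ‖w τ‖ * Real.sin (w τ).arg = B τ := fun τ => by
    rw [Complex.norm_mul_sin_arg, him]
  have hC : ∀ τ, ‖w τ‖ * Real.cos (ξ τ) = Real.cos τ := by
    intro τ
    have a := hcos τ
    have b := hsin τ
    simp only [hA, hB] at a b
    simp only [hξ, Real.cos_add]
    linear_combination Real.cos τ * a - Real.sin τ * b + Real.cos τ * hc1 τ
  have hS : ∀ τ, ‖w τ‖ * Real.sin (ξ τ) = k₁ * Real.cos τ + k₂ * Real.sin τ := by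
    intro τ
    have a := hcos τ
    have b := hsin τ
    simp only [hA, hB] at a b
    simp only [hξ, Real.sin_add]
    linear_combination Real.sin τ * a + Real.cos τ * b +
      (k₁ * Real.cos τ + k₂ * Real.sin τ) * hc1 τ
  have hder : ∀ τ, HasDerivAt ξ (k₂ / (A τ ^ 2 + B τ ^ 2)) τ := by
    intro τ
    have dc := Real.hasDerivAt_cos τ
    have ds := Real.hasDerivAt_sin τ
    have dq := (dc.const_mul k₁).add (ds.const_mul k₂)
    have dA := (dc.pow 2).add (dq.mul ds)
    have dB := (dq.mul dc).sub (dc.mul ds)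
    have dA' : HasDerivAt A (-2 * Real.cos τ * Real.sin τ
        + (-k₁ * Real.sin τ + k₂ * Real.cos τ) * Real.sin τ
        + (k₁ * Real.cos τ + k₂ * Real.sin τ) * Real.cos τ) τ := by
      refine dA.congr_deriv ?_
      simp; ring
    have dB' : HasDerivAt B ((-k₁ * Real.sin τ + k₂ * Real.cos τ) * Real.cos τ
        - (k₁ * Real.cos τ + k₂ * Real.sin τ) * Real.sin τ
        + Real.sin τ ^ 2 - Real.cos τ ^ 2) τ := by
      refine dB.congr_deriv ?_
      simp; ring
    have dw : HasDerivAt w _ τ := dA'.ofReal_comp.add (dB'.ofReal_comp.mul_const Complex.I)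
    have dl := dw.clog_real (hslit τ)
    have di := Complex.imCLM.hasFDerivAt.comp_hasDerivAt τ dl
    have dx := (hasDerivAt_id τ).add di
    have he : ξ = (id + (Complex.imCLM ∘ fun t => Complex.log (w t))) := by
      funext t
      simp [hξ, Complex.log_im]
    rw [he]
    refine dx.congr_deriv ?_
    rw [Complex.imCLM_apply, Complex.div_im, Complex.normSq_apply, hre, him,
      ← pow_two, ← pow_two]
    have hne := (hpos2 τ).ne'
    simp only [Complex.add_im, Complex.add_re, Complex.ofReal_re, Complex.ofReal_im,
      Complex.mul_re, Complex.mul_im, Complex.I_re, Complex.I_im]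
    rw [← sub_div, eq_div_iff hne, add_mul, div_mul_cancel₀ _ hne]
    simp only [hA, hB]
    linear_combination k₂ * (Real.cos τ ^ 2 + Real.sin τ ^ 2 + 1) * hc1 τ
  have hmono : StrictMono ξ :=
    strictMono_of_hasDerivAt_pos hder (fun τ => div_pos hk₂ (hpos2 τ))
  have hrw : ∀ τ, r τ = (Real.sqrt k₂)⁻¹ * ‖w τ‖ := fun τ => by rw [hr, hnorm]
  have h0 : |(w 0).arg| < Real.pi / 2 := by
    rw [Complex.abs_arg_lt_pi_div_two_iff, hre]
    left; simp [hA]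
  rw [abs_lt] at h0
  refine ⟨ξ, hmono, ?_, ?_, ?_, ?_, ?_, ?_, ?_, ?_⟩
  · exact continuous_iff_continuousAt.mpr fun τ => (hder τ).continuousAt
  · simpa [hξ] using h0.1
  · simpa [hξ] using h0.2
  · intro τ
    rw [hrw, mul_assoc, mul_assoc, hC, hS]
    exact ⟨rfl, rfl⟩
  · intro τ hτ
    have hcne : Real.cos τ ≠ 0 := by
      intro h
      obtain ⟨k, hk⟩ := Real.cos_eq_zero_iff.mp h
      exact hτ k (by rw [hk]; ring)
    have hp := (hpos τ).ne'
    rw [Real.tan_eq_sin_div_cos, Real.tan_eq_sin_div_cos,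
      ← mul_div_mul_left _ _ hp, hC, hS]
    field_simp
  · intro k
    have hc : Real.cos (Real.pi / 2 + k * Real.pi) = 0 :=
      Real.cos_eq_zero_iff.mpr ⟨k, by ring⟩
    have h2 := hc1 (Real.pi / 2 + k * Real.pi)
    rw [hc] at h2
    have a : A (Real.pi / 2 + k * Real.pi) = k₂ := by
      simp only [hA, hc]
      linear_combination k₂ * h2
    have b : B (Real.pi / 2 + k * Real.pi) = 0 := by
      simp only [hB, hc]; ring
    have : w (Real.pi / 2 + k * Real.pi) = (k₂ : ℂ) := by
      simp only [hw]
      rw [a, b]; simp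
    simp only [hξ]
    rw [this, Complex.arg_ofReal_of_nonneg hk₂.le, add_zero]
  · refine Filter.tendsto_atTop_mono (f := fun τ => τ + -Real.pi) (fun τ => ?_)
      (Filter.tendsto_atTop_add_const_right _ _ Filter.tendsto_id)
    have := Complex.neg_pi_lt_arg (w τ)
    simp only [hξ]; linarith
  · refine Filter.tendsto_atBot_mono (f := fun τ => τ + Real.pi) (fun τ => ?_)
      (Filter.tendsto_atBot_add_const_right _ _ Filter.tendsto_id)
    have := Complex.arg_le_pi (w τ)
    simp only [hξ]; linarith
end
end

section
/- Let X(σ,λ) = α₀Q_c(σ,λ)* − β₀Q_s(σ,λ)* (so X = −Q₁). Then for every λ ∈ ℝ and every τ ∈ (0,T), the symmetric matrix ∫₀^τ X(σ,λ)·E(σ)·X(σ,λ)* dσ is positive definite; equivalently, the matrix C₂ = −∫₀^τ X(σ,λ)E(σ)X(σ,λ)* dσ is negative definite for all τ ∈ (0,T). -/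
open Matrix
noncomputable section
attribute [local instance] Matrix.normedAddCommGroup Matrix.normedSpace

theorem clm_integral_comm {V W : Type*} [NormedAddCommGroup V] [NormedSpace ℝ V] [CompleteSpace V]
    [NormedAddCommGroup W] [NormedSpace ℝ W] [CompleteSpace W] (L : V →L[ℝ] W) {a b : ℝ}
    (hab : a ≤ b) (f : ℝ → V) (hf : ContinuousOn f (Set.Icc a b)) :
    ∫ x in a..b, L (f x) = L (∫ x in a..b, f x) := by
  apply L.intervalIntegral_comp_comm
  apply ContinuousOn.intervalIntegrable
  rwa [Set.uIcc_of_le hab]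

theorem cont_transpose {n : ℕ} {s : Set ℝ} {f : ℝ → Mat n} (hf : ContinuousOn f s) :
    ContinuousOn (fun x => (f x)ᵀ) s :=
  (Continuous.matrix_transpose continuous_id).comp_continuousOn hf

theorem cont_mul {n : ℕ} {s : Set ℝ} {f g : ℝ → Mat n} (hf : ContinuousOn f s)
    (hg : ContinuousOn g s) : ContinuousOn (fun x => f x * g x) s :=
  hf.mul hg

/-- `C₂` is negative definite in the Sturm–Liouville setting: with
`X = α₀Q_c* − β₀Q_s* = −Q₁`, the matrix `∫₀^τ X E X* dσ` is positive definite
for all `τ ∈ (0,T)`; equivalently `C₂ = −∫₀^τ X E X* dσ` is negative definite. -/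
theorem sturm_liouville_C₂_negDef
    (n : ℕ) (hn : 1 ≤ n) (T : EReal) (hT : 0 < T)
    (S : Set ℝ) (hS : S = {τ : ℝ | 0 ≤ τ ∧ (τ : EReal) < T})
    (C₀ D E : ℝ → Mat n)
    (hC₀c : ContinuousOn C₀ S) (hDc : ContinuousOn D S) (hEc : ContinuousOn E S)
    (hC₀s : ∀ τ ∈ S, (C₀ τ)ᵀ = C₀ τ) (hDs : ∀ τ ∈ S, (D τ)ᵀ = D τ)
    (hEs : ∀ τ ∈ S, (E τ)ᵀ = E τ)
    (hC₀pos : ∀ τ ∈ S, (C₀ τ).PosDef) (hEpos : ∀ τ ∈ S, (E τ).PosDef)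
    (Qc Pc Qs Ps : ℝ → ℝ → Mat n)
    (hQc' : ∀ l : ℝ, ∀ τ ∈ S,
      HasDerivWithinAt (fun σ => Qc σ l) (C₀ τ * Pc τ l) S τ)
    (hPc' : ∀ l : ℝ, ∀ τ ∈ S,
      HasDerivWithinAt (fun σ => Pc σ l) ((D τ - l • E τ) * Qc τ l) S τ)
    (hQs' : ∀ l : ℝ, ∀ τ ∈ S,
      HasDerivWithinAt (fun σ => Qs σ l) (C₀ τ * Ps τ l) S τ)
    (hPs' : ∀ l : ℝ, ∀ τ ∈ S,
      HasDerivWithinAt (fun σ => Ps σ l) ((D τ - l • E τ) * Qs τ l) S τ)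
    (hQc0 : ∀ l : ℝ, Qc 0 l = 1) (hPs0 : ∀ l : ℝ, Ps 0 l = 1)
    (hQs0 : ∀ l : ℝ, Qs 0 l = 0) (hPc0 : ∀ l : ℝ, Pc 0 l = 0)
    (α₀ β₀ : Mat n)
    (hαβ1 : α₀ * α₀ᵀ + β₀ * β₀ᵀ = 1) (hαβ2 : α₀ * β₀ᵀ = β₀ * α₀ᵀ)
    (δ : Mat n) (hδ : δᵀ = δ)
    (Q₂ Q₁ : ℝ → ℝ → Mat n)
    (hQ₂def : ∀ τ l, Q₂ τ l =
      (α₀ * (Qc τ l)ᵀ - β₀ * (Qs τ l)ᵀ) * δ + α₀ * (Pc τ l)ᵀ - β₀ * (Ps τ l)ᵀ)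
    (hQ₁def : ∀ τ l, Q₁ τ l = -(α₀ * (Qc τ l)ᵀ) + β₀ * (Qs τ l)ᵀ)
    (X : ℝ → ℝ → Mat n)
    (hXdef : ∀ σ l, X σ l = α₀ * (Qc σ l)ᵀ - β₀ * (Qs σ l)ᵀ) :
    ∀ l : ℝ, ∀ τ : ℝ, 0 < τ → (τ : EReal) < T →
      (∫ σ in (0:ℝ)..τ, X σ l * E σ * (X σ l)ᵀ).PosDef ∧
      (-(-(∫ σ in (0:ℝ)..τ, X σ l * E σ * (X σ l)ᵀ))).PosDef := by
  intro l τ hτ hτT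
  have hsub : Set.Icc 0 τ ⊆ S := by
    intro x hx
    rw [hS]
    exact ⟨hx.1, lt_of_le_of_lt (by exact_mod_cast hx.2) hτT⟩
  have hQcc : ContinuousOn (fun σ => Qc σ l) (Set.Icc 0 τ) :=
    fun x hx => ((hQc' l x (hsub hx)).continuousWithinAt).mono hsub
  have hQsc : ContinuousOn (fun σ => Qs σ l) (Set.Icc 0 τ) :=
    fun x hx => ((hQs' l x (hsub hx)).continuousWithinAt).mono hsub
  have hEc' : ContinuousOn E (Set.Icc 0 τ) := hEc.mono hsub
  have hXc : ContinuousOn (fun σ => X σ l) (Set.Icc 0 τ) := by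
    simp only [hXdef]
    have h1 := cont_transpose hQcc
    have h2 := cont_transpose hQsc
    exact (cont_mul continuousOn_const h1).sub (cont_mul continuousOn_const h2)
  have hFc : ContinuousOn (fun σ => X σ l * E σ * (X σ l)ᵀ) (Set.Icc 0 τ) :=
    cont_mul (cont_mul hXc hEc') (cont_transpose hXc)
  have key : (∫ σ in (0:ℝ)..τ, X σ l * E σ * (X σ l)ᵀ).PosDef := by
    apply Matrix.PosDef.of_dotProduct_mulVec_pos
    · let L : Mat n →L[ℝ] Mat n :=
        LinearMap.toContinuousLinearMap (Matrix.transposeLinearEquiv (Fin n) (Fin n) ℝ ℝ).toLinearMap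
      have hL : ∀ M, L M = Mᵀ := fun M => rfl
      have hc : (∫ σ in (0:ℝ)..τ, L (X σ l * E σ * (X σ l)ᵀ)) =
          L (∫ σ in (0:ℝ)..τ, X σ l * E σ * (X σ l)ᵀ) := clm_integral_comm L hτ.le _ hFc
      rw [Matrix.IsHermitian, Matrix.conjTranspose_eq_transpose_of_trivial, ← hL,
        ← hc]
      apply intervalIntegral.integral_congr
      intro σ hσ
      rw [Set.uIcc_of_le hτ.le] at hσ
      simp only [hL, Matrix.transpose_mul, Matrix.transpose_transpose, hEs σ (hsub hσ),
        Matrix.mul_assoc]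
    · intro v hv
      let l0 : Mat n →ₗ[ℝ] ℝ :=
        { toFun := fun M => star v ⬝ᵥ (M *ᵥ v)
          map_add' := fun A B => by simp [Matrix.add_mulVec, dotProduct_add]
          map_smul' := fun c A => by simp [Matrix.smul_mulVec] }
      let L : Mat n →L[ℝ] ℝ := LinearMap.toContinuousLinearMap l0
      have hL : ∀ M, L M = star v ⬝ᵥ (M *ᵥ v) := fun M => rfl
      have hquad : ∀ σ, L (X σ l * E σ * (X σ l)ᵀ) =
          star ((X σ l)ᵀ *ᵥ v) ⬝ᵥ (E σ *ᵥ ((X σ l)ᵀ *ᵥ v)) := by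
        intro σ
        rw [hL, ← Matrix.mulVec_mulVec, ← Matrix.mulVec_mulVec, Matrix.dotProduct_mulVec]
        congr 1
        simp [Matrix.mulVec_transpose]
      have hc : (∫ σ in (0:ℝ)..τ, L (X σ l * E σ * (X σ l)ᵀ)) =
          L (∫ σ in (0:ℝ)..τ, X σ l * E σ * (X σ l)ᵀ) := clm_integral_comm L hτ.le _ hFc
      rw [← hL, ← hc]
      refine intervalIntegral.integral_pos hτ ?_ ?_ ?_
      · exact L.continuous.comp_continuousOn hFc
      · intro σ hσ
        rw [hquad]
        exact (hEpos σ (hsub ⟨hσ.1.le, hσ.2⟩)).posSemidef.dotProduct_mulVec_nonneg _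
      · by_contra hcon
        push Not at hcon
        have hq0 : ∀ σ ∈ Set.Icc 0 τ, (X σ l)ᵀ *ᵥ v = 0 := by
          intro σ hσ
          by_contra hne
          have h1 := (hEpos σ (hsub hσ)).dotProduct_mulVec_pos hne
          have h2 := hcon σ hσ
          rw [hquad] at h2
          linarith
        have h0 : (0:ℝ) ∈ Set.Icc 0 τ := ⟨le_rfl, hτ.le⟩
        let m0 : (w : Fin n → ℝ) → Mat n →ₗ[ℝ] (Fin n → ℝ) := fun w =>
          { toFun := fun M => M *ᵥ w
            map_add' := fun A B => by simp [Matrix.add_mulVec]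
            map_smul' := fun c A => by simp [Matrix.smul_mulVec] }
        let m : (w : Fin n → ℝ) → Mat n →L[ℝ] (Fin n → ℝ) := fun w =>
          LinearMap.toContinuousLinearMap (m0 w)
        have hm : ∀ w M, m w M = M *ᵥ w := fun w M => rfl
        have d1 := (m (α₀ᵀ *ᵥ v)).hasFDerivAt.comp_hasDerivWithinAt 0 ((hQc' l 0 (hsub h0)).mono hsub)
        have d2 := (m (β₀ᵀ *ᵥ v)).hasFDerivAt.comp_hasDerivWithinAt 0 ((hQs' l 0 (hsub h0)).mono hsub)
        have d3 := d1.sub d2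
        have d4 : HasDerivWithinAt (fun _ : ℝ => (0 : Fin n → ℝ)) 0 (Set.Icc 0 τ) 0 :=
          hasDerivWithinAt_const _ _ _
        have d5 := d4.congr_of_mem (f₁ := (⇑(m (α₀ᵀ *ᵥ v)) ∘ fun σ => Qc σ l) -
          (⇑(m (β₀ᵀ *ᵥ v)) ∘ fun σ => Qs σ l)) (by
            intro σ hσ
            rw [← hq0 σ hσ]
            simp [hm, hXdef, Matrix.sub_mulVec, Matrix.mulVec_mulVec]) h0
        have heq : (C₀ 0 * Pc 0 l) *ᵥ (α₀ᵀ *ᵥ v) - (C₀ 0 * Ps 0 l) *ᵥ (β₀ᵀ *ᵥ v) = 0 :=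
          (uniqueDiffOn_Icc hτ 0 h0).eq_deriv _ d3 d5
        simp only [hPc0, hPs0, Matrix.mul_zero, Matrix.mul_one, Matrix.zero_mulVec,
          zero_sub, neg_eq_zero] at heq
        have hβ : β₀ᵀ *ᵥ v = 0 := by
          by_contra hne
          have := (hC₀pos 0 (hsub h0)).dotProduct_mulVec_pos hne
          rw [heq] at this
          simp at this
        have hα : α₀ᵀ *ᵥ v = 0 := by
          have := hq0 0 h0
          simpa [hXdef, hQc0, hQs0] using this
        apply hv
        calc v = (α₀ * α₀ᵀ + β₀ * β₀ᵀ) *ᵥ v := by rw [hαβ1, Matrix.one_mulVec]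
          _ = 0 := by
            rw [Matrix.add_mulVec, ← Matrix.mulVec_mulVec, ← Matrix.mulVec_mulVec, hα, hβ]
            simp
  exact ⟨key, by rwa [neg_neg]⟩
end
end
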